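/- Let F be a field of characteristic p > 0 and let S_1, ..., S_r ⊆ F be nonempty sets with pdeg(S_i) = k_i ∈ ℕ. Assume [F^p(S_1, ..., S_i) : F^p(S_1, ..., S_{i−1})] = p^{ℓ_i} with 0 ≤ ℓ_i ≤ k_i for i = 1, ..., r, let {c_{i1}, ..., c_{iℓ_i}} ⊆ F be p-independent with F^p(S_1, ..., S_i) = F^p(S_1, ..., S_{i−1})(c_{i1}, ..., c_{iℓ_i}), and extend these to a p-basis {c_{i1}, ..., c_{ik_i}} of F^p(S_i). Then Σ_{i=1}^r d c_{i1} ∧ ... ∧ d c_{ik_i} ∧ Ω^{n−k_i}(F) ⊆ annΩ^n_F(dS_1 ∧ ... ∧ dS_r) ⊆ Σ_{i=1}^r d c_{i1} ∧ ... ∧ d c_{iℓ_i} ∧ Ω^{n−ℓ_i}(F). -/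

import Mathlib

set_option synthInstance.maxHeartbeats 1000000
set_option maxHeartbeats 1000000

open ExteriorAlgebra

noncomputable section Preamble

variable (F : Type) [Field F] (p : ℕ)

/-- The subfield `F^{p^t}(C)` of `F` generated by the `p^t`-th powers and the set `C`. -/
def pClosureT (t : ℕ) (C : Set F) : Subfield F :=
  Subfield.closure ((Set.range fun x : F => x ^ p ^ t) ∪ C)

/-- The subfield `F^p(C)` of `F` generated by the `p`-th powers and the set `C`. -/
def pClosure (C : Set F) : Subfield F := pClosureT F p 1 C

/-- The degree `[B(A) : B]` for a subfield `B` of `F` and a subset `A ⊆ F`. -/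
def relDeg (B : Subfield F) (A : Set F) : ℕ :=
  Module.finrank B (IntermediateField.adjoin B A)

/-- `pdeg A = k`, i.e. `[F^p(A) : F^p] = p ^ k`. -/
def pDegEq (A : Set F) (k : ℕ) : Prop :=
  relDeg F (pClosure F p ∅) A = p ^ k

/-- A finite family `a : Fin n → F` is `p`-independent if `[F^p(a₁,…,aₙ) : F^p] = pⁿ`. -/
def pIndep {n : ℕ} (a : Fin n → F) : Prop :=
  pDegEq F p (Set.range a) n

/-- The exterior algebra of the absolute differential forms of `F`; the spaces `Ωⁿ(F)`
are its graded pieces and the wedge product is its multiplication. -/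
abbrev ExtOmega := ExteriorAlgebra F (Ω[F⁄ℤ])

/-- The differential `d a` of an element `a : F`, viewed in the exterior algebra. -/
def dform (a : F) : ExtOmega F :=
  ExteriorAlgebra.ι F (KaehlerDifferential.D ℤ F a)

/-- The space `Ωⁿ(F)` of `n`-differential forms, as a submodule of the exterior algebra;
it is `0` for `n < 0`. -/
def OmegaPow (n : ℤ) : Submodule F (ExtOmega F) :=
  if 0 ≤ n then ⋀[F]^(n.toNat) (Ω[F⁄ℤ]) else ⊥

/-- The wedge product `d a₁ ∧ … ∧ d aₙ` of the differentials of a family. -/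
def dwedge {n : ℕ} (a : Fin n → F) : ExtOmega F :=
  (List.ofFn fun i => dform F (a i)).prod

/-- The annihilator `annΩ^n_F(U)` of a set `U` of differential forms. -/
def annOmega (n : ℕ) (U : Set (ExtOmega F)) : Submodule F (ExtOmega F) :=
  OmegaPow F n ⊓ ⨅ u ∈ U, LinearMap.ker (LinearMap.mulRight F u)

/-- The logarithmic differential form `(dx₁/x₁) ∧ … ∧ (dxₙ/xₙ)`. -/
def logForm {n : ℕ} (x : Fin n → F) : ExtOmega F :=
  (List.ofFn fun i => ExteriorAlgebra.ι F ((x i)⁻¹ • KaehlerDifferential.D ℤ F (x i))).prod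

/-- The group `ν_n(F)`, additively generated by the logarithmic differential forms;
it is `0` for `n < 0`. -/
def nuPow (n : ℤ) : AddSubgroup (ExtOmega F) :=
  if 0 ≤ n then
    AddSubgroup.closure
      {ω | ∃ x : Fin n.toNat → F, (∀ i, x i ≠ 0) ∧ ω = logForm F x}
  else ⊥

/-- The annihilator `ann ν^n_F(U)`. -/
def annNu (n : ℕ) (U : Set (ExtOmega F)) : AddSubgroup (ExtOmega F) :=
  (annOmega F n U).toAddSubgroup ⊓ nuPow F n

/-- `η ∧ W` for a form `η` and a subspace `W`. -/
def wedgeL (η : ExtOmega F) (W : Submodule F (ExtOmega F)) : Submodule F (ExtOmega F) :=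
  W.map (LinearMap.mulLeft F η)

/-- The set `dS₁ ∧ … ∧ dSᵣ` for sets `S₁, …, Sᵣ ⊆ F`. -/
def dSet {r : ℕ} (S : Fin r → Set F) : Set (ExtOmega F) :=
  {ω | ∃ s : Fin r → F, (∀ i, s i ∈ S i) ∧ ω = dwedge F s}

/-- The additive subgroup `[dy₁/y₁ ∧ … ∧ dy_t/y_t ∣ yᵢ ∈ K^*] ∧ ν_m(F)` of `Ωⁿ(F)`
(for `n = t + m`). -/
def logWedgeNu (K : Set F) (t : ℕ) (m : ℤ) : AddSubgroup (ExtOmega F) :=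
  AddSubgroup.closure
    {ω | ∃ y : Fin t → F, (∀ i, y i ∈ K ∧ y i ≠ 0) ∧
      ∃ χ ∈ nuPow F m, ω = logForm F y * χ}

variable (E : Type) [Field E] [Algebra F E]

/-- The restriction map `Ω(F) → Ω(E)` on exterior algebras of differential forms,
induced by the inclusion `F ⊆ E`; it sends `d a` to `d a` and `x dа₁ ∧ … ∧ daₙ` to
the corresponding form over `E`. -/
def resMap : ExtOmega F →+* ExtOmega E :=
  letI : Algebra F (ExtOmega E) :=
    ((algebraMap E (ExtOmega E)).comp (algebraMap F E)).toAlgebra'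
      (fun c x => Algebra.commutes (algebraMap F E c) x)
  (ExteriorAlgebra.lift F ⟨{
      toFun := fun w =>
        ExteriorAlgebra.ι E (KaehlerDifferential.map ℤ ℤ F E w)
      map_add' := fun x y => by simp
      map_smul' := fun c x => by
        simp only [map_smul, RingHom.id_apply]
        rw [← algebraMap_smul E c (KaehlerDifferential.map ℤ ℤ F E x), map_smul,
          Algebra.smul_def, Algebra.smul_def]
        rfl },
    fun m => ExteriorAlgebra.ι_sq_zero _⟩).toRingHom

/-- The kernel `Ωⁿ(E/F)` of the restriction map `Ωⁿ(F) → Ωⁿ(E)`. -/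
def OmegaKer (n : ℕ) : Set (ExtOmega F) :=
  {ω | ω ∈ OmegaPow F n ∧ resMap F E ω = 0}

/-- The kernel `ν_n(E/F) = Ωⁿ(E/F) ∩ ν_n(F)`. -/
def nuKer (n : ℕ) : Set (ExtOmega F) :=
  OmegaKer F E n ∩ (nuPow F n : Set (ExtOmega F))

end Preamble


section PIndependence

open KaehlerDifferential

variable {F : Type} [Field F] {p : ℕ}

/-- A purely inseparable extension of exponent one has a differential detecting any given element
outside the base field. -/
lemma exists_dual_kaehlerDifferential_ne_zero [Fact p.Prime] [CharP F p] (K : Subfield F)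
    (hK : ∀ x : F, x ^ p ∈ K) {c : F} (hc : c ∉ K) :
    ∃ φ : Ω[F⁄ℤ] →ₗ[F] F, (∀ x ∈ K, φ (D ℤ F x) = 0) ∧ φ (D ℤ F c) ≠ 0 := by
  obtain ⟨M, hKM, hM⟩ := zorn_le_nonempty₀ {M : Subfield F | c ∉ M} (by
    intro C hC hchain y hy
    refine ⟨sSup C, ?_, fun z hz => le_sSup hz⟩
    intro h
    obtain ⟨z, hz, hcz⟩ := (Subfield.mem_sSup_of_directedOn ⟨y, hy⟩ hchain.directedOn).1 h
    exact hC hz hcz) K hc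
  have hcM : c ∉ M := hM.prop
  have hpow : ∀ x : F, x ^ p ∈ M := fun x => hKM (hK x)
  have : ExpChar M p := by
    have : CharP M p := (algebraMap M F).charP (algebraMap M F).injective p
    exact .prime Fact.out
  have hpi : IsPurelyInseparable M F :=
    (isPurelyInseparable_iff_pow_mem M p).2 fun x => ⟨1, ⟨x ^ p, hpow x⟩, by rw [pow_one]; rfl⟩
  have hint : ∀ x : F, IsIntegral M x := fun x => Algebra.IsIntegral.isIntegral x
  have hdeg : ∀ x : F, x ∉ M → Module.finrank M (IntermediateField.adjoin M {x}) = p := by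
    intro x hx
    have hirr : Irreducible (Polynomial.X ^ p - Polynomial.C (⟨x ^ p, hpow x⟩ : M)) := by
      refine X_pow_sub_C_irreducible_of_prime Fact.out fun b hb => hx ?_
      have : (b : F) ^ p = x ^ p := congrArg Subtype.val hb
      have := frobenius_inj F p (by simpa [frobenius_def] using this)
      exact this ▸ b.2
    rw [IntermediateField.adjoin.finrank (hint x), ← minpoly.eq_of_irreducible_of_monic hirr
      (by
        rw [map_sub, map_pow, Polynomial.aeval_X, Polynomial.aeval_C, sub_eq_zero]
        rfl)
      (Polynomial.monic_X_pow_sub_C _ (Fact.out : p.Prime).ne_zero),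
      Polynomial.natDegree_X_pow_sub_C]
  have htop : IntermediateField.adjoin M {c} = ⊤ := by
    refine eq_top_iff.2 fun x _ => ?_
    by_cases hx : x ∈ M
    · exact IntermediateField.algebraMap_mem (IntermediateField.adjoin M {c}) (⟨x, hx⟩ : M)
    have hcx : c ∈ IntermediateField.adjoin M {x} := by
      by_contra hcon
      have hle : M ≤ (IntermediateField.adjoin M {x}).toSubfield := fun y hy =>
        IntermediateField.algebraMap_mem (IntermediateField.adjoin M {x}) (⟨y, hy⟩ : M)
      exact hx (hM.le_of_ge (y := (IntermediateField.adjoin M {x}).toSubfield) hcon hle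
        (IntermediateField.mem_adjoin_simple_self M x))
    have : FiniteDimensional M (IntermediateField.adjoin M {x}) :=
      IntermediateField.adjoin.finiteDimensional (hint x)
    have heq : IntermediateField.adjoin M {c} = IntermediateField.adjoin M {x} :=
      IntermediateField.eq_of_le_of_finrank_eq
        (IntermediateField.adjoin_simple_le_iff.2 hcx) (by rw [hdeg c hcM, hdeg x hx])
    exact heq ▸ IntermediateField.mem_adjoin_simple_self M x
  have hfin : FiniteDimensional M F := by
    have := IntermediateField.adjoin.finiteDimensional (hint c)
    rw [htop] at this
    exact IntermediateField.topEquiv.toLinearEquiv.finiteDimensional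
  have hDc : D M F c ≠ 0 := by
    intro h0
    have hall : ∀ x : F, D M F x = 0 := by
      intro x
      have hx : x ∈ IntermediateField.adjoin M {c} := htop ▸ IntermediateField.mem_top
      induction hx using IntermediateField.adjoin_induction with
      | mem x hx => rw [Set.mem_singleton_iff.1 hx, h0]
      | algebraMap x => exact (D M F).map_algebraMap x
      | add x y _ _ hx hy => rw [map_add, hx, hy, add_zero]
      | inv x _ hx => rw [Derivation.leibniz_inv, hx, smul_zero]
      | mul x y _ _ hx hy => rw [Derivation.leibniz, hx, hy, smul_zero, smul_zero, add_zero]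
    have hsub : Subsingleton (Ω[F⁄M]) := by
      rw [← Submodule.subsingleton_iff F, ← subsingleton_iff_bot_eq_top, ← span_range_derivation,
        eq_comm, Submodule.span_eq_bot]
      rintro _ ⟨x, rfl⟩
      exact hall x
    have : Algebra.FormallyUnramified M F := ⟨hsub⟩
    have hr := Algebra.FormallyUnramified.range_eq_top_of_isPurelyInseparable M F
    obtain ⟨m, hm⟩ : c ∈ (algebraMap M F).range := hr ▸ trivial
    exact hcM (hm ▸ m.2)
  obtain ⟨ψ, hψ⟩ := Module.Projective.exists_dual_ne_zero F hDc
  refine ⟨ψ ∘ₗ KaehlerDifferential.map ℤ M F F, fun x hx => ?_, by simpa using hψ⟩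
  have : D M F x = 0 := (D M F).map_algebraMap ⟨x, hKM hx⟩
  simp [this]

lemma pow_mem_pClosure (A : Set F) (x : F) : x ^ p ∈ pClosure F p A :=
  Subfield.subset_closure (Or.inl ⟨x, by simp⟩)

lemma subset_pClosure (A : Set F) : A ⊆ pClosure F p A :=
  fun _ hx => Subfield.subset_closure (Or.inr hx)

lemma pClosure_le_iff {A : Set F} {K : Subfield F} (hK : ∀ x : F, x ^ p ∈ K) :
    pClosure F p A ≤ K ↔ A ⊆ K := by
  rw [pClosure, pClosureT, Subfield.closure_le, Set.union_subset_iff, and_iff_right]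
  rintro _ ⟨x, rfl⟩
  simpa using hK x

lemma pClosure_mono {A B : Set F} (h : A ⊆ B) : pClosure F p A ≤ pClosure F p B :=
  (pClosure_le_iff (pow_mem_pClosure B)).2 (h.trans (subset_pClosure B))

lemma kaehlerDifferential_mem_span_of_mem_pClosure [CharP F p] {A : Set F} {x : F}
    (hx : x ∈ pClosure F p A) : D ℤ F x ∈ Submodule.span F (D ℤ F '' A) := by
  rw [pClosure, pClosureT] at hx
  induction hx using Subfield.closure_induction with
  | mem x hx =>
    rcases hx with ⟨y, rfl⟩ | hx
    · simp [Derivation.leibniz_pow, ← Nat.cast_smul_eq_nsmul F]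
    · exact Submodule.subset_span ⟨x, hx, rfl⟩
  | one => simp
  | add x y _ _ hx hy => rw [map_add]; exact add_mem hx hy
  | neg x _ hx => rw [map_neg]; exact neg_mem hx
  | inv x _ hx => rw [Derivation.leibniz_inv]; exact Submodule.smul_mem _ _ hx
  | mul x y _ _ hx hy =>
    rw [Derivation.leibniz]
    exact add_mem (Submodule.smul_mem _ _ hy) (Submodule.smul_mem _ _ hx)

lemma mem_pClosure_of_kaehlerDifferential_mem_span [Fact p.Prime] [CharP F p] {A : Set F} {x : F}
    (hx : D ℤ F x ∈ Submodule.span F (D ℤ F '' A)) : x ∈ pClosure F p A := by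
  by_contra hcon
  obtain ⟨φ, h0, h1⟩ := exists_dual_kaehlerDifferential_ne_zero _ (pow_mem_pClosure (p := p) A) hcon
  refine h1 (LinearMap.mem_ker.1 (Submodule.span_le.2 ?_ hx))
  rintro _ ⟨y, hy, rfl⟩
  exact h0 y (subset_pClosure A hy)

lemma toSubfield_adjoin_pClosure (U A : Set F) :
    (IntermediateField.adjoin (pClosure F p U) A).toSubfield = pClosure F p (U ∪ A) := by
  have hB : ∀ x ∈ pClosure F p U, x ∈ IntermediateField.adjoin (pClosure F p U) A := fun x hx =>
    IntermediateField.algebraMap_mem _ (⟨x, hx⟩ : pClosure F p U)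
  apply le_antisymm
  · intro x hx
    change x ∈ IntermediateField.adjoin (pClosure F p U) A at hx
    induction hx using IntermediateField.adjoin_induction with
    | mem x hx => exact subset_pClosure _ (Or.inr hx)
    | algebraMap x => exact pClosure_mono Set.subset_union_left x.2
    | add x y _ _ hx hy => exact add_mem hx hy
    | inv x _ hx => exact inv_mem hx
    | mul x y _ _ hx hy => exact mul_mem hx hy
  · refine (pClosure_le_iff fun x => hB _ (pow_mem_pClosure U x)).2 (Set.union_subset ?_ ?_)
    · exact fun x hx => hB x (subset_pClosure U hx)
    · exact IntermediateField.subset_adjoin _ A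

lemma relDeg_congr {U A A' : Set F} (h : pClosure F p (U ∪ A) = pClosure F p (U ∪ A')) :
    relDeg F (pClosure F p U) A = relDeg F (pClosure F p U) A' := by
  have : IntermediateField.adjoin (pClosure F p U) A =
      IntermediateField.adjoin (pClosure F p U) A' := by
    apply IntermediateField.toSubfield_injective
    rw [toSubfield_adjoin_pClosure, toSubfield_adjoin_pClosure, h]
  rw [relDeg, relDeg, this]

lemma relDeg_image_le [Fact p.Prime] (U : Set F) {ι : Type*} (c : ι → F) (s : Finset ι) :
    relDeg F (pClosure F p U) (c '' s) ≤ p ^ s.card := by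
  classical
  induction s using Finset.induction_on with
  | empty => rw [relDeg, Finset.coe_empty, Set.image_empty, IntermediateField.adjoin_empty]; simp
  | insert a s ha ih =>
    rw [relDeg, Finset.coe_insert, Set.image_insert_eq, Set.insert_eq,
      IntermediateField.adjoin_union, Finset.card_insert_of_notMem ha, pow_succ']
    refine (IntermediateField.finrank_sup_le _ _).trans (Nat.mul_le_mul ?_ ih)
    have hm : (Polynomial.X ^ p -
        Polynomial.C (⟨c a ^ p, pow_mem_pClosure U (c a)⟩ : pClosure F p U)).Monic :=
      Polynomial.monic_X_pow_sub_C _ (Fact.out : p.Prime).ne_zero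
    have hz : Polynomial.aeval (c a) (Polynomial.X ^ p -
        Polynomial.C (⟨c a ^ p, pow_mem_pClosure U (c a)⟩ : pClosure F p U)) = 0 := by
      simp [Algebra.algebraMap_eq_smul_one, Subfield.smul_def]
    rw [IntermediateField.adjoin.finrank ⟨_, hm, hz⟩]
    refine (Polynomial.natDegree_le_of_dvd (minpoly.dvd _ _ hz) hm.ne_zero).trans ?_
    rw [Polynomial.natDegree_X_pow_sub_C]

/-- Differentials of `p`-bases of the successive steps of a tower are linearly independent. -/
lemma linearIndependent_kaehlerDifferential_sigma [Fact p.Prime] [CharP F p] {r : ℕ}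
    {S : Fin r → Set F} {l : Fin r → ℕ} (c : (i : Fin r) → Fin (l i) → F)
    (hc : ∀ i j, c i j ∈ pClosure F p (S i))
    (hrel : ∀ i : Fin r,
      relDeg F (pClosure F p (⋃ j : Fin r, ⋃ _ : j < i, S j)) (S i) = p ^ l i)
    (hgen : ∀ i : Fin r,
      pClosure F p (⋃ j : Fin r, ⋃ _ : j ≤ i, S j) =
        pClosure F p ((⋃ j : Fin r, ⋃ _ : j < i, S j) ∪ Set.range (c i))) :
    LinearIndependent F fun x : (i : Fin r) × Fin (l i) => D ℤ F (c x.1 x.2) := by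
  classical
  rw [Fintype.linearIndependent_iff]
  intro a ha
  by_contra! hne
  obtain ⟨x₀, hx₀⟩ := hne
  obtain ⟨⟨i, j⟩, hx, hmax⟩ := Finset.exists_max_image
    (Finset.univ.filter fun x => a x ≠ 0) Sigma.fst ⟨x₀, by simpa using hx₀⟩
  simp only [Finset.mem_filter, Finset.mem_univ, true_and] at hx hmax
  set U : Set F := ⋃ j : Fin r, ⋃ _ : j < i, S j with hU
  set T : Finset (Fin (l i)) := Finset.univ.erase j with hT
  have hspan : D ℤ F (c i j) ∈ Submodule.span F (D ℤ F '' (U ∪ c i '' T)) := by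
    have hsum := Finset.add_sum_erase Finset.univ
      (fun x : (i : Fin r) × Fin (l i) => a x • D ℤ F (c x.1 x.2)) (Finset.mem_univ ⟨i, j⟩)
    rw [ha, add_eq_zero_iff_eq_neg] at hsum
    rw [← Submodule.smul_mem_iff _ hx, hsum]
    refine neg_mem (Submodule.sum_mem _ fun y hy => ?_)
    by_cases hay : a y = 0
    · simp [hay]
    refine Submodule.smul_mem _ _ ?_
    obtain ⟨i', j'⟩ := y
    rcases (hmax _ hay).lt_or_eq with hlt | heq
    · refine Submodule.span_mono (Set.image_mono ?_)
        (kaehlerDifferential_mem_span_of_mem_pClosure (hc i' j'))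
      exact Set.subset_union_of_subset_left 
        (Set.subset_iUnion₂ (s := fun (j : Fin r) (_ : j < i) => S j) i' hlt) _
    · obtain rfl : i' = i := heq
      refine Submodule.subset_span ⟨_, Or.inr ⟨j', ?_, rfl⟩, rfl⟩
      simpa [hT] using hy
  have hmem := mem_pClosure_of_kaehlerDifferential_mem_span (p := p) hspan
  have hUS : (⋃ j : Fin r, ⋃ _ : j ≤ i, S j) = U ∪ S i := by
    ext x
    simp only [hU, le_iff_lt_or_eq, Set.mem_iUnion, Set.mem_union, exists_prop, or_and_right,
      exists_or, exists_eq_left]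
  have heq : pClosure F p (U ∪ S i) = pClosure F p (U ∪ c i '' T) := by
    rw [← hUS, hgen i]
    refine le_antisymm ((pClosure_le_iff (pow_mem_pClosure _)).2 (Set.union_subset ?_ ?_))
      (pClosure_mono (Set.union_subset_union_right _ (Set.image_subset_range _ _)))
    · exact Set.subset_union_left.trans (subset_pClosure _)
    · rintro _ ⟨j', rfl⟩
      by_cases hj : j' = j
      · exact hj ▸ hmem
      · exact subset_pClosure _ (Or.inr ⟨j', by simpa [hT] using hj, rfl⟩)
  have hle := relDeg_image_le (p := p) U (c i) T
  rw [← relDeg_congr heq, hrel i, Nat.pow_le_pow_iff_right (Fact.out : p.Prime).one_lt, hT,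
    Finset.card_erase_of_mem (Finset.mem_univ _), Finset.card_fin] at hle
  have := j.pos
  omega

end PIndependence

section ExteriorAlgebra

open Module

variable {K V I : Type*} [Field K] [AddCommGroup V] [Module K V]

lemma ιMulti_comp_eq_smul_basis [LinearOrder I] (b : Basis I K V) {m : ℕ} {f : Fin m → I}
    (hf : Function.Injective f) :
    ∃ u : ℤˣ, ιMulti K m (b ∘ f) = u • b.ExteriorAlgebra (Finset.univ.image f) := by
  let s : Set.powersetCard I m :=
    ⟨Finset.univ.image f, by
      rw [Set.powersetCard.mem_iff, Finset.card_image_of_injective _ hf, Finset.card_fin]⟩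
  let e := Set.powersetCard.ofFinEmbEquiv.symm s
  have he : Set.range f = Set.range e := by
    ext x
    rw [Set.powersetCard.mem_range_ofFinEmbEquiv_symm_iff_mem s x]
    change _ ↔ x ∈ Finset.univ.image f
    simp
  let σ : Equiv.Perm (Fin m) := (Equiv.ofInjective f hf).trans
    ((Equiv.setCongr he).trans (Equiv.ofInjective e e.injective).symm)
  have hσ : b ∘ f = (b ∘ e) ∘ σ := by
    ext x
    have : e (σ x) = f x := Equiv.apply_ofInjective_symm e.injective _
    simp [this]
  refine ⟨Equiv.Perm.sign σ, ?_⟩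
  rw [hσ, AlternatingMap.map_perm]
  congr 1
  exact (basis_apply_powersetCard b s).symm

lemma basis_mul_eq_zero [LinearOrder I] (b : Basis I K V) {s t : Finset I} (h : ¬ Disjoint s t) :
    b.ExteriorAlgebra s * b.ExteriorAlgebra t = 0 :=
  basis_mul_of_not_disjoint b (⟨s, rfl⟩ : Set.powersetCard I s.card)
    (⟨t, rfl⟩ : Set.powersetCard I t.card) h

lemma basis_mul_eq_smul [LinearOrder I] (b : Basis I K V) {s t : Finset I} (h : Disjoint s t) :
    ∃ u : ℤˣ, b.ExteriorAlgebra s * b.ExteriorAlgebra t = u • b.ExteriorAlgebra (s ∪ t) := by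
  let s' : Set.powersetCard I s.card := ⟨s, rfl⟩
  let t' : Set.powersetCard I t.card := ⟨t, rfl⟩
  have h' : Disjoint s'.val t'.val := h
  have heq : (Set.powersetCard.disjUnion h').val = s ∪ t := by
    ext x
    simp [Set.powersetCard.disjUnion, s', t']
  exact ⟨_, heq ▸ basis_mul_of_disjoint b s' t' h'⟩

/-- If `ω` is annihilated by a monomial of a basis, its coordinates at the monomials disjoint from
it vanish. -/
lemma basis_repr_eq_zero_of_mul_eq_zero [LinearOrder I] (b : Basis I K V) {s t : Finset I}
    (h : Disjoint s t) {ω : ExteriorAlgebra K V} (hω : ω * b.ExteriorAlgebra t = 0) :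
    b.ExteriorAlgebra.repr ω s = 0 := by
  obtain ⟨u, hu⟩ := basis_mul_eq_smul b h
  have key : b.ExteriorAlgebra.coord (s ∪ t) ∘ₗ LinearMap.mulRight K (b.ExteriorAlgebra t) =
      u • b.ExteriorAlgebra.coord s := by
    refine b.ExteriorAlgebra.ext fun s' => ?_
    by_cases hs' : Disjoint s' t
    · by_cases heq : s' = s
      · subst heq
        simp [hu, Units.smul_def, ← Int.cast_smul_eq_zsmul K]
      · obtain ⟨u', hu'⟩ := basis_mul_eq_smul b hs'
        have hne : s' ∪ t ≠ s ∪ t := fun hun => heq <| by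
          rw [← Finset.union_sdiff_cancel_right hs', hun, Finset.union_sdiff_cancel_right h]
        simp [hu', Units.smul_def, ← Int.cast_smul_eq_zsmul K,
          Finsupp.single_eq_of_ne' hne, Finsupp.single_eq_of_ne' heq]
    · have hne : s' ≠ s := fun heq => hs' (heq ▸ h)
      simp [basis_mul_eq_zero b hs', Units.smul_def, Finsupp.single_eq_of_ne' hne]
  have := LinearMap.congr_fun key ω
  simp only [LinearMap.comp_apply, LinearMap.mulRight_apply, hω, map_zero, LinearMap.smul_apply,
    Basis.coord_apply] at this
  exact (smul_eq_zero_iff_eq u).1 this.symm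

/-- A form annihilated by all the products of transversals of a linearly independent family split
into blocks is a sum of multiples of the block products. -/
lemma mem_iSup_mulLeft_of_mul_ιMulti_eq_zero {r n : ℕ} {l : Fin r → ℕ}
    {v : (i : Fin r) → Fin (l i) → V}
    (hv : LinearIndependent K fun x : (i : Fin r) × Fin (l i) => v x.1 x.2)
    {ω : ExteriorAlgebra K V} (hω : ω ∈ ⋀[K]^n V)
    (h : ∀ j : (i : Fin r) → Fin (l i), ω * ιMulti K r (fun i => v i (j i)) = 0) :
    ω ∈ ⨆ (i : Fin r) (_ : l i ≤ n),
      (⋀[K]^(n - l i) V).map (LinearMap.mulLeft K (ιMulti K (l i) (v i))) := by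
  obtain ⟨I, b, f, hf, hb⟩ : ∃ (I : Set V) (b : Basis I K V)
      (f : (i : Fin r) × Fin (l i) → I), Function.Injective f ∧ ∀ i j, b (f ⟨i, j⟩) = v i j := by
    refine ⟨_, Basis.extend hv.linearIndepOn_id,
      fun x => ⟨v x.1 x.2, hv.linearIndepOn_id.subset_extend _ ⟨x, rfl⟩⟩, fun x y hxy => ?_, ?_⟩
    · exact hv.injective (congrArg Subtype.val hxy)
    · exact fun i j => Basis.extend_apply_self _ _
  let _ : LinearOrder I := by
    classical exact linearOrderOfSTO WellOrderingRel
  have hrepr : ∀ s : Set.powersetCard _ n, (b.exteriorPower n).repr ⟨ω, hω⟩ s =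
      b.ExteriorAlgebra.repr ω s := fun s => by
    have key : (b.exteriorPower n).coord s =
        b.ExteriorAlgebra.coord s ∘ₗ Submodule.subtype (⋀[K]^n V) :=
      (b.exteriorPower n).ext fun t => by
        rw [LinearMap.comp_apply, Submodule.subtype_apply, ← basis_eq_coe_basis, Basis.coord_apply,
          Basis.coord_apply, Basis.repr_self, Basis.repr_self, Finsupp.single_apply,
          Finsupp.single_apply]
        simp only [Subtype.ext_iff]
    exact LinearMap.congr_fun key ⟨ω, hω⟩
  have hsum := congrArg (Submodule.subtype (⋀[K]^n V))
    ((b.exteriorPower n).linearCombination_repr ⟨ω, hω⟩)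
  rw [Finsupp.linearCombination_apply, Finsupp.sum, map_sum, Submodule.subtype_apply] at hsum
  rw [show ω = _ from hsum.symm]
  refine Submodule.sum_mem _ fun s _ => ?_
  rw [map_smul, Submodule.subtype_apply, ← basis_eq_coe_basis, hrepr]
  by_cases hs : ∃ i, ∀ j, f ⟨i, j⟩ ∈ s.1
  · refine Submodule.smul_mem _ _ ?_
    obtain ⟨i, hi⟩ := hs
    have hinj : Function.Injective fun j : Fin (l i) =>
        f ⟨i, j⟩ := fun j j' hj => by
      simpa using hf hj
    obtain ⟨u, hu⟩ := ιMulti_comp_eq_smul_basis b hinj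
    set t := Finset.univ.image fun j : Fin (l i) =>
      f ⟨i, j⟩ with ht
    have hts : t ⊆ s.1 := by
      intro x hx
      obtain ⟨j, -, rfl⟩ := Finset.mem_image.1 hx
      exact hi j
    have htc : t.card = l i := by rw [ht, Finset.card_image_of_injective _ hinj, Finset.card_fin]
    have hle : l i ≤ n := by
      rw [← htc, ← s.2]
      exact Finset.card_le_card hts
    obtain ⟨u', hu'⟩ := basis_mul_eq_smul b (Finset.disjoint_sdiff (s := t) (t := s.1))
    rw [Finset.union_sdiff_of_subset hts] at hu'
    refine Submodule.mem_iSup_of_mem i (Submodule.mem_iSup_of_mem hle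
      ⟨u' • u • b.ExteriorAlgebra (s.1 \ t), ?_, ?_⟩)
    · have : (s.1 \ t).card = n - l i := by
        rw [Finset.card_sdiff_of_subset hts, htc]
        congr 1
        exact s.2
      simp only [Units.smul_def]
      refine zsmul_mem (zsmul_mem ?_ _) _
      rw [basis_apply_ofCard b this, ← ιMulti_span_fixedDegree]
      exact Submodule.subset_span ⟨_, rfl⟩
    · have hvi : v i = b ∘ fun j : Fin (l i) => f ⟨i, j⟩ := by
        ext j
        exact (hb i j).symm
      rw [LinearMap.mulLeft_apply, hvi, hu]
      rw [smul_mul_assoc, mul_smul_comm, mul_smul_comm, hu', smul_comm u' u, smul_smul, smul_smul,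
        smul_smul]
      simp
  · push Not at hs
    choose j hj using hs
    have hinj : Function.Injective fun i : Fin r =>
        f ⟨i, j i⟩ :=
      fun i i' hi => congrArg Sigma.fst (hf hi)
    obtain ⟨u, hu⟩ := ιMulti_comp_eq_smul_basis b hinj
    have hvj : (fun i => v i (j i)) = b ∘ fun i : Fin r => f ⟨i, j i⟩ := by
      ext i
      exact (hb i (j i)).symm
    have h0 := h j
    rw [hvj, hu, Units.smul_def, mul_smul_comm, ← Units.smul_def, smul_eq_zero_iff_eq] at h0
    rw [basis_repr_eq_zero_of_mul_eq_zero b _ h0, zero_smul]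
    · exact zero_mem _
    · rw [Finset.disjoint_right]
      intro x hx
      obtain ⟨i, -, rfl⟩ := Finset.mem_image.1 hx
      exact hj i

/-- A form annihilating all products of elements of given sets annihilates the products of elements
of their spans. -/
lemma mul_ιMulti_eq_zero_of_mem_span {r : ℕ} {A : Fin r → Set V} {ω : ExteriorAlgebra K V}
    (h : ∀ a : Fin r → V, (∀ i, a i ∈ A i) → ω * ιMulti K r a = 0) {x : Fin r → V}
    (hx : ∀ i, x i ∈ Submodule.span K (A i)) : ω * ιMulti K r x = 0 := by
  classical
  suffices H : ∀ t : Finset (Fin r), ∀ x : Fin r → V, (∀ i ∈ t, x i ∈ Submodule.span K (A i)) →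
      (∀ i ∉ t, x i ∈ A i) → ω * ιMulti K r x = 0 from
    H Finset.univ x (fun i _ => hx i) (by simp)
  intro t
  induction t using Finset.induction_on with
  | empty => exact fun x _ hx => h x fun i => hx i (by simp)
  | insert i t hi ih =>
    intro x hx hx'
    let φ : V →ₗ[K] ExteriorAlgebra K V :=
      LinearMap.mulLeft K ω ∘ₗ (ιMulti K r).toMultilinearMap.toLinearMap x i
    have hφ : Submodule.span K (A i) ≤ LinearMap.ker φ := by
      refine Submodule.span_le.2 fun y hy => ih (Function.update x i y) ?_ ?_
      · intro k hk
        rw [Function.update_of_ne (by rintro rfl; exact hi hk)]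
        exact hx k (Finset.mem_insert_of_mem hk)
      · intro k hk
        by_cases hki : k = i
        · subst hki
          simpa using hy
        · rw [Function.update_of_ne hki]
          exact hx' k (by simp [hki, hk])
    have := hφ (hx i (Finset.mem_insert_self i t))
    simpa [φ] using this

lemma ιMulti_mul_mul_ιMulti_eq_zero {k m r : ℕ} {v : Fin k → V} {x : Fin r → V} {i : Fin r}
    (hx : x i ∈ Submodule.span K (Set.range v)) {w : ExteriorAlgebra K V} (hw : w ∈ ⋀[K]^m V) :
    ιMulti K k v * w * ιMulti K r x = 0 := by
  have hle : ⋀[K]^m V ≤ LinearMap.ker (LinearMap.mulRight K (ιMulti K r x) ∘ₗ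
      LinearMap.mulLeft K (ιMulti K k v)) := by
    rw [← ιMulti_span_fixedDegree, Submodule.span_le]
    rintro _ ⟨a, rfl⟩
    simp only [SetLike.mem_coe, LinearMap.mem_ker, LinearMap.comp_apply, LinearMap.mulLeft_apply,
      LinearMap.mulRight_apply, ιMulti_mul_ιMulti]
    refine AlternatingMap.map_linearDependent _ _ fun hli => ?_
    refine hli.notMem_span_image (s := Set.range fun j => Fin.castAdd r (Fin.castAdd m j))
      (x := Fin.natAdd (k + m) i) ?_ ?_
    · rintro ⟨j, hj⟩
      have := congrArg Fin.val hj
      simp only [Fin.val_castAdd, Fin.val_natAdd] at this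
      omega
    · have hrange : Fin.append (Fin.append v a) x ''
          (Set.range fun j => Fin.castAdd r (Fin.castAdd m j)) = Set.range v := by
        rw [← Set.range_comp]
        congr 1
        ext j
        simp
      rwa [hrange, Fin.append_right]
  exact hle hw

end ExteriorAlgebra

section KaehlerDifferential

open KaehlerDifferential

variable {F : Type} [Field F] {p : ℕ}

lemma dwedge_eq_ιMulti {m : ℕ} (a : Fin m → F) :
    dwedge F a = ιMulti F m fun i => D ℤ F (a i) :=
  (ιMulti_apply _).symm

lemma OmegaPow_sub_natCast {n k : ℕ} (h : k ≤ n) :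
    OmegaPow F ((n : ℤ) - k) = ⋀[F]^(n - k) (Ω[F⁄ℤ]) := by
  rw [OmegaPow, if_pos (by omega)]
  congr 1
  omega

lemma OmegaPow_natCast (n : ℕ) : OmegaPow F (n : ℤ) = ⋀[F]^n (Ω[F⁄ℤ]) := by
  simp [OmegaPow]

lemma mem_annOmega_dSet_iff {n r : ℕ} {S : Fin r → Set F} {ω : ExtOmega F} :
    ω ∈ annOmega F n (dSet F S) ↔ ω ∈ ⋀[F]^n (Ω[F⁄ℤ]) ∧
      ∀ s : Fin r → F, (∀ i, s i ∈ S i) → ω * ιMulti F r (fun i => D ℤ F (s i)) = 0 := by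
  simp only [annOmega, dSet, Submodule.mem_inf, OmegaPow_natCast, Submodule.mem_iInf,
    LinearMap.mem_ker, LinearMap.mulRight_apply, Set.mem_ofPred_eq, forall_exists_index, and_imp,
    ← dwedge_eq_ιMulti]
  exact and_congr_right fun _ =>
    ⟨fun h s hs => h _ s hs rfl, fun h _ s hs hu => hu ▸ h s hs⟩

lemma wedgeL_dwedge_le_annOmega [CharP F p] {n r k : ℕ} {S : Fin r → Set F} (i : Fin r)
    {c : Fin k → F} (hc : S i ⊆ pClosure F p (Set.range c)) :
    wedgeL F (dwedge F c) (OmegaPow F ((n : ℤ) - k)) ≤ annOmega F n (dSet F S) := by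
  by_cases hk : k ≤ n
  · rw [OmegaPow_sub_natCast hk, dwedge_eq_ιMulti]
    rintro _ ⟨w, hw, rfl⟩
    refine mem_annOmega_dSet_iff.2 ⟨?_, fun s hs => ?_⟩
    · have := SetLike.mul_mem_graded (A := fun n : ℕ => ⋀[F]^n (Ω[F⁄ℤ]))
        (ιMulti_range F k ⟨fun i => D ℤ F (c i), rfl⟩) hw
      rwa [Nat.add_sub_cancel' hk] at this
    · refine ιMulti_mul_mul_ιMulti_eq_zero (i := i) ?_ hw
      have := kaehlerDifferential_mem_span_of_mem_pClosure (hc (hs i))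
      rwa [← Set.range_comp] at this
  · rw [OmegaPow, if_neg (by omega), wedgeL, Submodule.map_bot]
    exact bot_le

end KaehlerDifferential

/-- Proposition 3.7. For nonempty sets `Sᵢ ⊆ F` with `pdeg Sᵢ = kᵢ`,
`[F^p(S₁,…,Sᵢ) : F^p(S₁,…,S_{i−1})] = p^{ℓᵢ}` with `0 ≤ ℓᵢ ≤ kᵢ`, `p`-independent
`{c_{i1},…,c_{iℓᵢ}}` with `F^p(S₁,…,Sᵢ) = F^p(S₁,…,S_{i−1})(c_{i1},…,c_{iℓᵢ})` extended to a
`p`-basis `{c_{i1},…,c_{ikᵢ}}` of `F^p(Sᵢ)`: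
`Σᵢ d c_{i1} ∧ … ∧ d c_{ikᵢ} ∧ Ω^{n−kᵢ}(F) ⊆ annΩ^n_F(dS₁ ∧ … ∧ dS_r)
⊆ Σᵢ d c_{i1} ∧ … ∧ d c_{iℓᵢ} ∧ Ω^{n−ℓᵢ}(F)`. -/
theorem stmt10 (F : Type) [Field F] (p : ℕ) [Fact p.Prime] [CharP F p]
    (n r : ℕ) (S : Fin r → Set F) (hS : ∀ i, (S i).Nonempty)
    (k l : Fin r → ℕ) (hdeg : ∀ i, pDegEq F p (S i) (k i)) (hlk : ∀ i, l i ≤ k i)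
    (hrel : ∀ i : Fin r,
      relDeg F (pClosure F p (⋃ j : Fin r, ⋃ _ : j < i, S j)) (S i) = p ^ l i)
    (c : (i : Fin r) → Fin (k i) → F)
    (hcind : ∀ i, pIndep F p fun j : Fin (l i) => c i (Fin.castLE (hlk i) j))
    (hcgen : ∀ i : Fin r,
      pClosure F p (⋃ j : Fin r, ⋃ _ : j ≤ i, S j) =
        pClosure F p ((⋃ j : Fin r, ⋃ _ : j < i, S j) ∪
          Set.range fun j : Fin (l i) => c i (Fin.castLE (hlk i) j)))
    (hcbasis : ∀ i, pIndep F p (c i) ∧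
      pClosure F p (Set.range (c i)) = pClosure F p (S i)) :
    (⨆ i, wedgeL F (dwedge F (c i)) (OmegaPow F ((n : ℤ) - k i)))
        ≤ annOmega F n (dSet F S) ∧
      annOmega F n (dSet F S) ≤
        ⨆ i, wedgeL F (dwedge F fun j : Fin (l i) => c i (Fin.castLE (hlk i) j))
          (OmegaPow F ((n : ℤ) - l i)) := by
  have hSc : ∀ i, S i ⊆ pClosure F p (Set.range (c i)) := fun i =>
    (hcbasis i).2 ▸ subset_pClosure (S i)
  have hcS : ∀ i j, c i j ∈ pClosure F p (S i) := fun i j =>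
    (hcbasis i).2 ▸ subset_pClosure _ (Set.mem_range_self j)
  refine ⟨iSup_le fun i => wedgeL_dwedge_le_annOmega i (hSc i), fun ω hω => ?_⟩
  obtain ⟨hωn, hω⟩ := mem_annOmega_dSet_iff.1 hω
  have hli := linearIndependent_kaehlerDifferential_sigma
    (fun i (j : Fin (l i)) => c i (Fin.castLE (hlk i) j)) (fun i j => hcS i _) hrel hcgen
  have hmem := mem_iSup_mulLeft_of_mul_ιMulti_eq_zero
    (v := fun i j => KaehlerDifferential.D ℤ F (c i (Fin.castLE (hlk i) j))) hli hωn fun j =>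
      mul_ιMulti_eq_zero_of_mem_span (A := fun i => KaehlerDifferential.D ℤ F '' S i)
        (fun a ha => by
          choose s hs hsa using ha
          simpa only [hsa] using hω s hs)
        fun i => kaehlerDifferential_mem_span_of_mem_pClosure (hcS i _)
  refine SetLike.le_def.1 (iSup_mono fun i => iSup_le fun hi => ?_) hmem
  rw [wedgeL, dwedge_eq_ιMulti, OmegaPow_sub_natCast hi]
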